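/- arXiv:1506.04640 — 7 statements merged into one kernel-verified Lean document; each statement's English description precedes it below -/
import Mathlib

section
/- Let C ≥ 1 be a real number and let α : ℝ → ℝ be twice differentiable with α''(t) ≥ α'(t)² − (1 − 1/C) for every t ∈ ℝ. Then α'(t)² ≤ 1 − 1/C for every t ∈ ℝ. -/
/-- A function on the whole line with `f' ≥ f ^ 2 - k ^ 2` cannot exceed `k`: otherwise it would
blow up in finite time. -/
theorem le_of_sq_sub_sq_le_deriv {f : ℝ → ℝ} {k : ℝ} (hk : 0 ≤ k) (hf : Differentiable ℝ f)
    (h : ∀ t, f t ^ 2 - k ^ 2 ≤ deriv f t) (t : ℝ) : f t ≤ k := by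
  by_contra! ht
  have hmono : Monotone fun s => (f s - k) * Real.exp (-(2 * k * s)) := by
    have hd (s : ℝ) : HasDerivAt (fun s => (f s - k) * Real.exp (-(2 * k * s)))
        (deriv f s * Real.exp (-(2 * k * s)) +
          (f s - k) * (Real.exp (-(2 * k * s)) * -(2 * k * 1))) s :=
      ((hf s).hasDerivAt.sub_const k).mul (((hasDerivAt_id s).const_mul (2 * k)).neg.exp)
    refine monotone_of_deriv_nonneg (fun s => (hd s).differentiableAt) fun s => ?_
    rw [(hd s).deriv]
    have := mul_nonneg (Real.exp_pos (-(2 * k * s))).le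
      (show 0 ≤ deriv f s - 2 * k * (f s - k) by nlinarith [h s, sq_nonneg (f s - k)])
    linarith
  have hpos {s : ℝ} (hs : t ≤ s) : 0 < f s - k :=
    pos_of_mul_pos_left ((mul_pos (sub_pos.2 ht) (Real.exp_pos _)).trans_le (hmono hs))
      (Real.exp_pos _).le
  have hanti : AntitoneOn (fun s => (f s - k)⁻¹ + s) (Set.Ici t) := by
    have hd {s : ℝ} (hs : t ≤ s) : HasDerivAt (fun s => (f s - k)⁻¹ + s)
        (-deriv f s / (f s - k) ^ 2 + 1) s :=
      (((hf s).hasDerivAt.sub_const k).fun_inv (hpos hs).ne').add (hasDerivAt_id s)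
    refine antitoneOn_of_deriv_nonpos (convex_Ici t)
      (fun s hs => (hd hs).continuousAt.continuousWithinAt)
      (fun s hs => (hd (interior_subset hs)).differentiableAt.differentiableWithinAt)
      fun s hs => ?_
    have hs' := hpos (interior_subset hs)
    rw [(hd (interior_subset hs)).deriv, neg_div, neg_add_nonpos_iff, one_le_div (by positivity)]
    nlinarith [h s, mul_nonneg hk hs'.le]
  have hlt : t ≤ t + (f t - k)⁻¹ := le_add_of_nonneg_right (inv_nonneg.2 (sub_pos.2 ht).le)
  have hle := hanti Set.self_mem_Ici hlt hlt
  have := inv_pos.2 (hpos hlt)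
  simp only at hle
  linarith

/-- If `C ≥ 1` and `α : ℝ → ℝ` is twice differentiable with
`α'' t ≥ (α' t)^2 - (1 - 1/C)` for all `t`, then `(α' t)^2 ≤ 1 - 1/C` for all `t`. -/
theorem stmt_0 (C : ℝ) (hC : 1 ≤ C) (α : ℝ → ℝ)
    (hα : Differentiable ℝ α) (hα' : Differentiable ℝ (deriv α))
    (h : ∀ t : ℝ, deriv (deriv α) t ≥ (deriv α t) ^ 2 - (1 - 1 / C)) :
    ∀ t : ℝ, (deriv α t) ^ 2 ≤ 1 - 1 / C := by
  intro t
  have hC' : 0 ≤ 1 - 1 / C := sub_nonneg.2 ((div_le_one (by linarith)).2 hC)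
  have hsq := Real.sq_sqrt hC'
  have hd (s : ℝ) : HasDerivAt (fun s => -deriv α (-s)) (deriv (deriv α) (-s)) s := by
    simpa using ((hα' (-s)).hasDerivAt.scomp s (hasDerivAt_neg s)).fun_neg
  have hupper := le_of_sq_sub_sq_le_deriv (Real.sqrt_nonneg _) hα'
    (fun s => by rw [hsq]; exact h s) t
  have hlower := le_of_sq_sub_sq_le_deriv (Real.sqrt_nonneg (1 - 1 / C))
    (fun s => (hd s).differentiableAt)
    (fun s => by rw [hsq, (hd s).deriv, neg_sq]; exact h (-s)) (-t)
  rw [neg_neg] at hlower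
  rw [← hsq]
  exact sq_le_sq' (by linarith) hupper
end

section
/- Let a ≥ 0 be a real number and let g : ℝ → ℝ be differentiable on all of ℝ with g'(t) ≥ g(t)² − a² for every t ∈ ℝ. Then |g(t)| ≤ a for every t ∈ ℝ. -/
/-- A differentiable function on `ℝ` with `g' ≥ g² - a²`, where `a ≥ 0`, is bounded above by `a`. -/
theorem le_of_sq_sub_sq_le_deriv_s1 {a : ℝ} (ha : 0 ≤ a) {g : ℝ → ℝ} (hg : Differentiable ℝ g)
    (h : ∀ t, g t ^ 2 - a ^ 2 ≤ deriv g t) (s : ℝ) : g s ≤ a := by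
  by_contra! hs
  have hexp : ∀ t, HasDerivAt (fun t => (g t - a) * Real.exp (-(2 * a * t)))
      ((deriv g t - 2 * a * (g t - a)) * Real.exp (-(2 * a * t))) t := fun t => by
    have h₁ : HasDerivAt (fun t : ℝ => -(2 * a * t)) (-(2 * a)) t :=
      (((hasDerivAt_id' t).const_mul (2 * a)).fun_neg).congr_deriv (by ring)
    exact (((hg t).hasDerivAt.sub_const a).fun_mul h₁.exp).congr_deriv (by ring)
  have hmono : Monotone (fun t => (g t - a) * Real.exp (-(2 * a * t))) := by
    refine monotone_of_deriv_nonneg (fun t => (hexp t).differentiableAt) fun t => ?_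
    rw [(hexp t).deriv]
    exact mul_nonneg (by nlinarith [h t, sq_nonneg (g t - a)]) (Real.exp_pos _).le
  have hpos : ∀ t, s ≤ t → 0 < g t - a := fun t ht =>
    pos_of_mul_pos_left
      ((mul_pos (sub_pos.2 hs) (Real.exp_pos _)).trans_le (hmono ht)) (Real.exp_pos _).le
  have hinv : ∀ t, s ≤ t → HasDerivAt (fun t => (g t - a)⁻¹ + t)
      (-deriv g t / (g t - a) ^ 2 + 1) t := fun t ht =>
    (((hg t).hasDerivAt.sub_const a).inv (hpos t ht).ne').add (hasDerivAt_id t)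
  have hanti : AntitoneOn (fun t => (g t - a)⁻¹ + t) (Set.Ici s) := by
    refine antitoneOn_of_deriv_nonpos (convex_Ici s)
      (fun t ht => (hinv t ht).continuousAt.continuousWithinAt)
      (fun t ht => (hinv t (interior_subset ht)).differentiableAt.differentiableWithinAt)
      fun t ht => ?_
    have hp := hpos t (interior_subset ht)
    rw [(hinv t (interior_subset ht)).deriv, neg_div]
    have : 1 ≤ deriv g t / (g t - a) ^ 2 := by
      rw [le_div_iff₀ (by positivity)]
      nlinarith [h t, mul_nonneg ha hp.le]
    linarith
  have hle : s ≤ s + (g s - a)⁻¹ := le_add_of_nonneg_right (inv_pos.2 (hpos s le_rfl)).le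
  have hfinal := hanti Set.self_mem_Ici (Set.mem_Ici.2 hle) hle
  have := inv_pos.2 (hpos _ hle)
  dsimp only at hfinal
  linarith

/-- If `a ≥ 0` and `g : ℝ → ℝ` is differentiable on all of `ℝ` with
`g' t ≥ (g t)^2 - a^2` for all `t`, then `|g t| ≤ a` for all `t`. -/
theorem stmt_1 (a : ℝ) (ha : 0 ≤ a) (g : ℝ → ℝ)
    (hg : Differentiable ℝ g)
    (h : ∀ t : ℝ, deriv g t ≥ (g t) ^ 2 - a ^ 2) :
    ∀ t : ℝ, |g t| ≤ a := by
  intro t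
  refine abs_le.2 ⟨?_, le_of_sq_sub_sq_le_deriv_s1 ha hg h t⟩
  have hrefl : ∀ s, HasDerivAt (fun s => -g (-s)) (deriv g (-s)) s := fun s =>
    ((hg (-s)).hasDerivAt.comp s (hasDerivAt_neg s)).fun_neg.congr_deriv (by ring)
  have := le_of_sq_sub_sq_le_deriv_s1 ha (fun s => (hrefl s).differentiableAt)
    (fun s => by rw [(hrefl s).deriv, neg_sq]; exact h (-s)) (-t)
  rw [neg_neg] at this
  linarith
end

section
/- Let V be a real normed vector space, let e₁, e₂ ∈ V, and let α : ℝ → ℝ be twice differentiable. Define u : ℝ → V by u(t) = e^{t + α(t)}·e₁ + e^{−t + α(t)}·e₂. Then u is twice differentiable and for every t ∈ ℝ, u''(t) = (α''(t) − α'(t)² + 1)·u(t) + 2α'(t)·u'(t). -/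
theorem hasDerivAt_exp_comp_smul {V : Type*} [NormedAddCommGroup V] [NormedSpace ℝ V]
    {f : ℝ → ℝ} {f' t : ℝ} (hf : HasDerivAt f f' t) (e : V) :
    HasDerivAt (fun s => Real.exp (f s) • e) (f' • Real.exp (f t) • e) t := by
  simpa only [smul_smul, mul_comm] using hf.exp.smul_const e


/-- For `u t = e^{t + α t} • e₁ + e^{-t + α t} • e₂` with `α` twice differentiable,
`u` is twice differentiable and `u'' t = (α'' t - (α' t)^2 + 1) • u t + (2 α' t) • u' t`. -/
theorem stmt_4 {V : Type*} [NormedAddCommGroup V] [NormedSpace ℝ V] (e₁ e₂ : V)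
    (α : ℝ → ℝ) (hα : Differentiable ℝ α) (hα' : Differentiable ℝ (deriv α)) :
    let u : ℝ → V := fun t => Real.exp (t + α t) • e₁ + Real.exp (-t + α t) • e₂
    Differentiable ℝ u ∧ Differentiable ℝ (deriv u) ∧
      ∀ t : ℝ, deriv (deriv u) t
        = (deriv (deriv α) t - (deriv α t) ^ 2 + 1) • u t + (2 * deriv α t) • deriv u t := by
  intro u
  have hpos (t : ℝ) : HasDerivAt (fun s => s + α s) (1 + deriv α t) t :=
    (hasDerivAt_id' t).add (hα t).hasDerivAt
  have hneg (t : ℝ) : HasDerivAt (fun s => -s + α s) (-1 + deriv α t) t :=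
    (hasDerivAt_neg' t).add (hα t).hasDerivAt
  have hu (t : ℝ) : HasDerivAt u ((1 + deriv α t) • Real.exp (t + α t) • e₁ +
      (-1 + deriv α t) • Real.exp (-t + α t) • e₂) t :=
    (hasDerivAt_exp_comp_smul (hpos t) e₁).add (hasDerivAt_exp_comp_smul (hneg t) e₂)
  have hdu := deriv_eq hu
  have hu' (t : ℝ) : HasDerivAt (deriv u)
      ((deriv (deriv α) t - (deriv α t) ^ 2 + 1) • u t + (2 * deriv α t) • deriv u t) t := by
    have h := (((hα' t).hasDerivAt.const_add 1).smul
      (hasDerivAt_exp_comp_smul (hpos t) e₁)).add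
      (((hα' t).hasDerivAt.const_add (-1)).smul (hasDerivAt_exp_comp_smul (hneg t) e₂))
    rw [hdu]
    refine h.congr_deriv ?_
    simp only [u]
    module
  exact ⟨fun t => (hu t).differentiableAt, fun t => (hu' t).differentiableAt,
    fun t => (hu' t).deriv⟩
end

section
/- Let α : ℝ → ℝ be twice continuously differentiable and let t₁ < t₂ be real numbers with α''(t) − α'(t)² + 1 ≥ 0 for every t ∈ [t₁, t₂]. Then ∫_{t₁}^{t₂} √(α''(t) − α'(t)² + 1) dt ≤ (t₂ − t₁) · √(1 + (α'(t₂) − α'(t₁))/(t₂ − t₁)). -/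
theorem sq_intervalIntegral_le {g : ℝ → ℝ} (hg : Continuous g) {a b : ℝ} (hab : a < b) :
    (∫ t in a..b, g t) ^ 2 ≤ (b - a) * ∫ t in a..b, g t ^ 2 := by
  have hL : 0 < b - a := sub_pos.2 hab
  set I := ∫ t in a..b, g t with hI
  have h0 : 0 ≤ ∫ t in a..b, ((b - a) * g t - I) ^ 2 :=
    intervalIntegral.integral_nonneg hab.le fun t _ => sq_nonneg _
  have h1 : ∫ t in a..b, ((b - a) * g t - I) ^ 2 =
      (b - a) ^ 2 * (∫ t in a..b, g t ^ 2) - 2 * (b - a) * I * I + (b - a) * I ^ 2 := by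
    have hexp : ∀ t, ((b - a) * g t - I) ^ 2 =
        (b - a) ^ 2 * g t ^ 2 - 2 * (b - a) * I * g t + I ^ 2 := fun t => by ring
    simp_rw [hexp]
    rw [intervalIntegral.integral_add (Continuous.intervalIntegrable (by fun_prop) _ _)
        (Continuous.intervalIntegrable (by fun_prop) _ _),
      intervalIntegral.integral_sub (Continuous.intervalIntegrable (by fun_prop) _ _)
        (Continuous.intervalIntegrable (by fun_prop) _ _),
      intervalIntegral.integral_const_mul, intervalIntegral.integral_const_mul,
      intervalIntegral.integral_const, smul_eq_mul, ← hI]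
  rw [h1] at h0
  refine le_of_mul_le_mul_left ?_ hL
  linarith

/-- Cauchy–Schwarz step: for `α` of class `C²` with `α'' - α'^2 + 1 ≥ 0` on `[t₁, t₂]`,
`∫_{t₁}^{t₂} √(α'' - α'^2 + 1) ≤ (t₂ - t₁) √(1 + (α'(t₂) - α'(t₁))/(t₂ - t₁))`. -/
theorem stmt_5 (α : ℝ → ℝ) (hα : ContDiff ℝ 2 α) (t₁ t₂ : ℝ) (ht : t₁ < t₂)
    (h : ∀ t ∈ Set.Icc t₁ t₂, deriv (deriv α) t - (deriv α t) ^ 2 + 1 ≥ 0) :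
    ∫ t in t₁..t₂, Real.sqrt (deriv (deriv α) t - (deriv α t) ^ 2 + 1)
      ≤ (t₂ - t₁) * Real.sqrt (1 + (deriv α t₂ - deriv α t₁) / (t₂ - t₁)) := by
  have hL : 0 < t₂ - t₁ := sub_pos.2 ht
  have hα' : ContDiff ℝ 1 (deriv α) := by
    have h2 : ContDiff ℝ (1 + 1) α := by simpa [one_add_one_eq_two] using hα
    exact (contDiff_succ_iff_deriv.1 h2).2.2
  have hc : Continuous (deriv α) := hα'.continuous
  have hc' : Continuous (deriv (deriv α)) := hα'.continuous_deriv le_rfl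
  have hsq : ∫ t in t₁..t₂, Real.sqrt (deriv (deriv α) t - (deriv α t) ^ 2 + 1) ^ 2 ≤
      deriv α t₂ - deriv α t₁ + (t₂ - t₁) := by
    calc _ ≤ ∫ t in t₁..t₂, (deriv (deriv α) t + 1) := by
          refine intervalIntegral.integral_mono_on ht.le
            (Continuous.intervalIntegrable (by fun_prop) _ _)
            (Continuous.intervalIntegrable (by fun_prop) _ _) fun t hmem => ?_
          rw [Real.sq_sqrt (h t hmem)]
          linarith [sq_nonneg (deriv α t)]
      _ = _ := by
          rw [intervalIntegral.integral_add (hc'.intervalIntegrable _ _)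
            (Continuous.intervalIntegrable (by fun_prop) _ _),
            intervalIntegral.integral_deriv_eq_sub
              (fun t _ => (hα'.differentiable one_ne_zero) t) (hc'.intervalIntegrable _ _)]
          simp
  have hcs := sq_intervalIntegral_le
    (g := fun t => Real.sqrt (deriv (deriv α) t - (deriv α t) ^ 2 + 1)) (by fun_prop) ht
  rw [← div_le_iff₀' hL]
  refine Real.le_sqrt_of_sq_le ?_
  rw [div_pow, div_le_iff₀ (by positivity)]
  calc _ ≤ _ := hcs
    _ ≤ (t₂ - t₁) * (deriv α t₂ - deriv α t₁ + (t₂ - t₁)) := by gcongr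
    _ = _ := by field_simp; ring
end

section
/- Let α : ℝ → ℝ be twice continuously differentiable, let s ≥ 0, and let t₁ ≤ t₂ be real numbers such that for every t ∈ [t₁, t₂] one has α''(t) − α'(t)² + 1 ≥ 0 and |α'(t)| ≤ s. Then ∫_{t₁}^{t₂} √(α''(t) − α'(t)² + 1) dt ≤ (t₂ − t₁) + s. -/
/-- Length bound: for `α` of class `C²` with `α'' - α'^2 + 1 ≥ 0` and `|α'| ≤ s` on `[t₁, t₂]`,
`∫_{t₁}^{t₂} √(α'' - α'^2 + 1) ≤ (t₂ - t₁) + s`. -/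
theorem stmt_6 (α : ℝ → ℝ) (hα : ContDiff ℝ 2 α) (s : ℝ) (hs : 0 ≤ s)
    (t₁ t₂ : ℝ) (ht : t₁ ≤ t₂)
    (h : ∀ t ∈ Set.Icc t₁ t₂, deriv (deriv α) t - (deriv α t) ^ 2 + 1 ≥ 0)
    (h' : ∀ t ∈ Set.Icc t₁ t₂, |deriv α t| ≤ s) :
    ∫ t in t₁..t₂, Real.sqrt (deriv (deriv α) t - (deriv α t) ^ 2 + 1)
      ≤ (t₂ - t₁) + s := by
  have hd : ContDiff ℝ 1 (deriv α) := hα.deriv'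
  have hc : Continuous (deriv (deriv α)) := hd.continuous_deriv le_rfl
  have hi : IntervalIntegrable (deriv (deriv α)) MeasureTheory.volume t₁ t₂ :=
    hc.intervalIntegrable _ _
  calc ∫ t in t₁..t₂, Real.sqrt (deriv (deriv α) t - (deriv α t) ^ 2 + 1)
      ≤ ∫ t in t₁..t₂, (deriv (deriv α) t / 2 + 1) := by
        refine intervalIntegral.integral_mono_on ht ?_ ?_ fun t htt => ?_
        · exact ((hc.sub (hd.continuous.pow 2)).add continuous_const).sqrt.intervalIntegrable _ _
        · exact ((hc.div_const 2).add continuous_const).intervalIntegrable _ _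
        · nlinarith [Real.sq_sqrt (h t htt), sq_nonneg (deriv α t),
            sq_nonneg (Real.sqrt (deriv (deriv α) t - (deriv α t) ^ 2 + 1) - 1)]
    _ = (deriv α t₂ - deriv α t₁) / 2 + (t₂ - t₁) := by
        rw [intervalIntegral.integral_add (hi.div_const 2) intervalIntegrable_const,
          intervalIntegral.integral_div, intervalIntegral.integral_deriv_eq_sub
            (fun t _ => hd.differentiable one_ne_zero t) hi]
        simp
    _ ≤ (t₂ - t₁) + s := by
        linarith [le_of_abs_le (h' t₂ ⟨ht, le_rfl⟩), neg_le_of_abs_le (h' t₁ ⟨le_rfl, ht⟩)]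
end

section
/- Let C ≥ 1 and let α : ℝ → ℝ be twice continuously differentiable with α''(t) − α'(t)² + 1 ≥ 1/C for every t ∈ ℝ. Then for all real numbers t₁ ≤ t₂, ∫_{t₁}^{t₂} √(α''(t) − α'(t)² + 1) dt ≤ (t₂ − t₁) + √(1 − 1/C). -/
/-- A global solution of the Riccati inequality `f' ≥ f² - k²` never exceeds `k`. -/
lemma le_of_riccati {f f' : ℝ → ℝ} {k : ℝ} (hk : 0 ≤ k)
    (hf : ∀ t, HasDerivAt f (f' t) t) (hineq : ∀ t, f t ^ 2 - k ^ 2 ≤ f' t) (t₀ : ℝ) :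
    f t₀ ≤ k := by
  by_contra! hlt
  have hmono : Monotone fun t => (f t - k) * Real.exp (-(2 * k * t)) := by
    have hd : ∀ t, HasDerivAt (fun t => (f t - k) * Real.exp (-(2 * k * t)))
        ((f' t - 2 * k * (f t - k)) * Real.exp (-(2 * k * t))) t := by
      intro t
      have he : HasDerivAt (fun t : ℝ => -(2 * k * t)) (-(2 * k * 1)) t :=
        ((hasDerivAt_id t).const_mul (2 * k)).neg
      exact (((hf t).sub_const k).mul he.exp).congr_deriv (by ring)
    refine monotone_of_hasDerivAt_nonneg hd fun t => ?_
    refine mul_nonneg ?_ (Real.exp_pos _).le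
    nlinarith [hineq t, sq_nonneg (f t - k)]
  have hpos : ∀ t, t₀ ≤ t → 0 < f t - k := by
    intro t ht
    have h₀ : 0 < (f t₀ - k) * Real.exp (-(2 * k * t₀)) :=
      mul_pos (sub_pos.2 hlt) (Real.exp_pos _)
    exact pos_of_mul_pos_left (h₀.trans_le (hmono ht)) (Real.exp_pos _).le
  have hanti : AntitoneOn (fun t => (f t - k)⁻¹ + t) (Set.Ici t₀) := by
    have hd : ∀ t ∈ Set.Ici t₀, HasDerivAt (fun t => (f t - k)⁻¹ + t)
        (-f' t / (f t - k) ^ 2 + 1) t := fun t ht =>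
      (((hf t).sub_const k).inv (hpos t ht).ne').add (hasDerivAt_id t)
    refine antitoneOn_of_hasDerivWithinAt_nonpos (f' := fun t => -f' t / (f t - k) ^ 2 + 1)
      (convex_Ici t₀)
      (fun t ht => (hd t ht).continuousAt.continuousWithinAt)
      (fun t ht => (hd t (interior_subset ht)).hasDerivWithinAt) fun t ht => ?_
    have hp := hpos t (interior_subset ht)
    have : 1 ≤ f' t / (f t - k) ^ 2 := by
      rw [one_le_div (by positivity)]
      nlinarith [hineq t, mul_nonneg hk hp.le]
    rw [neg_div]
    linarith
  have hc : 0 < (f t₀ - k)⁻¹ := inv_pos.2 (sub_pos.2 hlt)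
  have hle : t₀ ≤ t₀ + (f t₀ - k)⁻¹ := by linarith
  have h₁ := hanti Set.self_mem_Ici hle hle
  have h₂ := inv_pos.2 (hpos _ hle)
  simp only at h₁
  linarith

/-- A global solution of the Riccati inequality `f' ≥ f² - k²` takes values in `[-k, k]`. -/
lemma abs_le_of_riccati {f f' : ℝ → ℝ} {k : ℝ} (hk : 0 ≤ k)
    (hf : ∀ t, HasDerivAt f (f' t) t) (hineq : ∀ t, f t ^ 2 - k ^ 2 ≤ f' t) (t : ℝ) :
    |f t| ≤ k := by
  refine abs_le'.2 ⟨le_of_riccati hk hf hineq t, ?_⟩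
  have hd : ∀ s, HasDerivAt (fun s => -f (-s)) (f' (-s)) s := fun s =>
    ((hf (-s)).scomp s (hasDerivAt_neg s)).neg.congr_deriv (by simp)
  simpa using le_of_riccati hk hd (fun s => by simpa using hineq (-s)) (-t)

/-- Sharp comparison along a chord: if `C ≥ 1` and `α'' - α'^2 + 1 ≥ 1/C` on `ℝ`, then
`∫_{t₁}^{t₂} √(α'' - α'^2 + 1) ≤ (t₂ - t₁) + √(1 - 1/C)` for all `t₁ ≤ t₂`. -/
theorem stmt_7 (C : ℝ) (hC : 1 ≤ C) (α : ℝ → ℝ) (hα : ContDiff ℝ 2 α)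
    (h : ∀ t : ℝ, deriv (deriv α) t - (deriv α t) ^ 2 + 1 ≥ 1 / C) :
    ∀ t₁ t₂ : ℝ, t₁ ≤ t₂ →
      ∫ t in t₁..t₂, Real.sqrt (deriv (deriv α) t - (deriv α t) ^ 2 + 1)
        ≤ (t₂ - t₁) + Real.sqrt (1 - 1 / C) := by
  intro t₁ t₂ ht
  have hα' : ContDiff ℝ 1 (deriv α) :=
    (contDiff_succ_iff_deriv (n := 1).1 (by simpa [one_add_one_eq_two] using hα)).2.2
  have hc : Continuous (deriv α) := hα'.continuous
  have hc' : Continuous (deriv (deriv α)) := hα'.continuous_deriv le_rfl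
  have hd : ∀ t, HasDerivAt (deriv α) (deriv (deriv α) t) t := fun t =>
    (hα'.differentiable one_ne_zero t).hasDerivAt
  have hC' : 0 ≤ 1 - 1 / C := by
    rw [sub_nonneg, div_le_one (by linarith)]
    exact hC
  have hb := abs_le_of_riccati (Real.sqrt_nonneg (1 - 1 / C)) hd fun t => by
    rw [Real.sq_sqrt hC']
    linarith [h t]
  have hpos : ∀ t, 0 ≤ deriv (deriv α) t - deriv α t ^ 2 + 1 := fun t =>
    (by positivity : 0 ≤ 1 / C).trans (h t)
  calc ∫ t in t₁..t₂, Real.sqrt (deriv (deriv α) t - (deriv α t) ^ 2 + 1)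
      ≤ ∫ t in t₁..t₂, (deriv (deriv α) t / 2 + 1) := by
        refine intervalIntegral.integral_mono_on ht
          (Continuous.intervalIntegrable (by fun_prop) _ _)
          (Continuous.intervalIntegrable (by fun_prop) _ _) fun t _ => ?_
        nlinarith [Real.sq_sqrt (hpos t), sq_nonneg (deriv α t),
          sq_nonneg (Real.sqrt (deriv (deriv α) t - deriv α t ^ 2 + 1) - 1)]
    _ = (deriv α t₂ / 2 + t₂) - (deriv α t₁ / 2 + t₁) :=
        intervalIntegral.integral_eq_sub_of_hasDerivAt
          (f := fun t => deriv α t / 2 + t)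
          (fun t _ => ((hd t).div_const 2).add (hasDerivAt_id t))
          (Continuous.intervalIntegrable (by fun_prop) _ _)
    _ ≤ (t₂ - t₁) + Real.sqrt (1 - 1 / C) := by
        linarith [(abs_le.1 (hb t₁)).1, (abs_le.1 (hb t₂)).2]
end

section
/- If α : ℝ → ℝ is twice continuously differentiable and α''(t) − α'(t)² + 1 ≥ 1 for every t ∈ ℝ, then α is constant. -/
/-- A global solution of the Riccati inequality `u ^ 2 ≤ deriv u` is nonpositive. -/
lemma nonpos_of_sq_le_deriv {u : ℝ → ℝ} (hu : Differentiable ℝ u)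
    (h : ∀ t, u t ^ 2 ≤ deriv u t) (t : ℝ) : u t ≤ 0 := by
  by_contra! hpos
  have hmono : Monotone u := monotone_of_deriv_nonneg hu fun x => (sq_nonneg _).trans (h x)
  have hpos' : ∀ x ∈ Set.Ici t, 0 < u x := fun x hx => hpos.trans_le (hmono hx)
  have hderiv : ∀ x ∈ Set.Ici t,
      HasDerivAt (fun y => -(u y)⁻¹ - y) (deriv u x / u x ^ 2 - 1) x := fun x hx => by
    simpa [neg_div] using
      ((hu x).hasDerivAt.fun_inv (hpos' x hx).ne').fun_neg.fun_sub (hasDerivAt_id' x)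
  have hmono' : MonotoneOn (fun y => -(u y)⁻¹ - y) (Set.Ici t) := by
    refine monotoneOn_of_deriv_nonneg (convex_Ici t)
      (fun x hx => (hderiv x hx).continuousAt.continuousWithinAt)
      (fun x hx => (hderiv x (interior_subset hx)).differentiableAt.differentiableWithinAt)
      fun x hx => ?_
    have hx' := interior_subset hx
    rw [(hderiv x hx').deriv, sub_nonneg, one_le_div (pow_pos (hpos' x hx') 2)]
    exact h x
  have hle : t ≤ t + (u t)⁻¹ := le_add_of_nonneg_right (inv_nonneg.2 hpos.le)
  have hcmp := hmono' Set.self_mem_Ici hle hle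
  have hinv := inv_pos.2 (hpos' _ hle)
  dsimp only at hcmp
  linarith

/-- The only global solution of the Riccati inequality `u ^ 2 ≤ deriv u` is zero. -/
lemma eq_zero_of_sq_le_deriv {u : ℝ → ℝ} (hu : Differentiable ℝ u)
    (h : ∀ t, u t ^ 2 ≤ deriv u t) (t : ℝ) : u t = 0 := by
  refine le_antisymm (nonpos_of_sq_le_deriv hu h t) ?_
  have hreflect : Differentiable ℝ fun x => -u (-x) := (hu.comp differentiable_neg).neg
  have := nonpos_of_sq_le_deriv hreflect (fun x => by
    rw [deriv.fun_neg, deriv_comp_neg]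
    simpa using h (-x)) (-t)
  simpa using this

/-- Rigidity: if `α` is `C²` on `ℝ` and `α'' - α'^2 + 1 ≥ 1` everywhere, then `α` is constant. -/
theorem stmt_8 (α : ℝ → ℝ) (hα : ContDiff ℝ 2 α)
    (h : ∀ t : ℝ, deriv (deriv α) t - (deriv α t) ^ 2 + 1 ≥ 1) :
    ∀ s t : ℝ, α s = α t := by
  have hα' : Differentiable ℝ (deriv α) :=
    (hα.deriv' (n := 1)).differentiable one_ne_zero
  exact is_const_of_deriv_eq_zero (hα.differentiable two_ne_zero)
    (eq_zero_of_sq_le_deriv hα' fun t => by linarith [h t])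
end
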